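/- For every integer s ≥ 1 there exists a (unique) polynomial J_s(X,Y) ∈ ℤ[X,Y], monic in X of degree ψ(s), such that for all ω ∈ ℍ one has J_s(X, j(ω)) = ∏_{ν=1}^{ψ(s)} (X − j(S_ν·ω)); that is, the coefficients of the principal polynomial of j(S·ω) over the field ℂ(j(ω)) are polynomials in j(ω) with rational integer coefficients. -/

import Mathlib

open Polynomial Complex IntermediateField

noncomputable section

/-- 2×2 integer matrices. -/
abbrev Mat : Type := Matrix (Fin 2) (Fin 2) ℤ

/-- The modular group SL₂(ℤ). -/
abbrev SL2Z := Matrix.SpecialLinearGroup (Fin 2) ℤ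

/-- A 2×2 integer matrix is primitive if the gcd of its four entries is 1. -/
def Mat.IsPrimitive (S : Mat) : Prop :=
  Nat.gcd (Nat.gcd (S 0 0).natAbs (S 0 1).natAbs)
    (Nat.gcd (S 1 0).natAbs (S 1 1).natAbs) = 1

/-- Left equivalence of matrices under SL₂(ℤ). -/
def LeftEquiv (S T : Mat) : Prop := ∃ M : SL2Z, S = (M : Mat) * T

/-- Möbius action of an integer matrix on a complex number. -/
def moeb (S : Mat) (z : ℂ) : ℂ :=
  ((S 0 0 : ℂ) * z + (S 0 1 : ℂ)) / ((S 1 0 : ℂ) * z + (S 1 1 : ℂ))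

/-- ψ(s) = s·∏_{p∣s}(1+1/p) = Σ_{d∣s squarefree} s/d. -/
def psi (s : ℕ) : ℕ := ∑ d ∈ s.divisors, if Squarefree d then s / d else 0

/-- Eisenstein series g₂. -/
def g2C (z : ℂ) : ℂ :=
  60 * ∑' w : {v : ℤ × ℤ // v ≠ 0}, ((w.1.1 : ℂ) * z + (w.1.2 : ℂ)) ^ (-4 : ℤ)

/-- Eisenstein series g₃. -/
def g3C (z : ℂ) : ℂ :=
  140 * ∑' w : {v : ℤ × ℤ // v ≠ 0}, ((w.1.1 : ℂ) * z + (w.1.2 : ℂ)) ^ (-6 : ℤ)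

/-- The discriminant Δ. -/
def discC (z : ℂ) : ℂ := g2C z ^ 3 - 27 * g3C z ^ 2

/-- The modular invariant j. -/
def jC (z : ℂ) : ℂ := 1728 * g2C z ^ 3 / discC z

/-- A family of matrices is a complete system of representatives of the left SL₂(ℤ)-orbits
of primitive integer matrices of determinant `s`. -/
def IsOrbitReps (s : ℕ) {n : ℕ} (R : Fin n → Mat) : Prop :=
  (∀ ν, (R ν).IsPrimitive ∧ (R ν).det = (s : ℤ)) ∧
  ∀ T : Mat, T.IsPrimitive → T.det = (s : ℤ) → ∃! ν, LeftEquiv T (R ν)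

/-- Evaluation of an integer polynomial at j(z). -/
def evalAtJ (z : ℂ) : Polynomial ℤ →+* ℂ := eval₂RingHom (Int.castRingHom ℂ) (jC z)

/-- J is the modular polynomial of level s: an element of ℤ[Y][X], monic in X of degree ψ(s),
such that J(X, j(ω)) = ∏_ν (X − j(S_ν ω)) for every ω in the upper half-plane. -/
def IsModularPoly (s : ℕ) (J : Polynomial (Polynomial ℤ)) : Prop :=
  J.Monic ∧ J.natDegree = psi s ∧
  ∀ R : Fin (psi s) → Mat, IsOrbitReps s R → ∀ z : ℂ, 0 < z.im →
    J.map (evalAtJ z) = ∏ ν, (X - C (jC (moeb (R ν) z)))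

/-- The one-variable polynomial J(X,X) obtained by setting Y = X. -/
def diagPoly (J : Polynomial (Polynomial ℤ)) : Polynomial ℤ := J.eval Polynomial.X

/-- φ_S(ω) = s¹²·Δ(Sω)/((cω+d)¹²·Δ(ω)). -/
def phiS (S : Mat) (z : ℂ) : ℂ :=
  (S.det : ℂ) ^ 12 * discC (moeb S z) /
    (((S 1 0 : ℂ) * z + (S 1 1 : ℂ)) ^ 12 * discC z)

/-- K is an imaginary quadratic subfield of ℂ. -/
def IsImagQuad (K : Subfield ℂ) : Prop :=
  ∃ θ : ℂ, 0 < θ.im ∧ Module.finrank ℚ ℚ⟮θ⟯ = 2 ∧ K = ℚ⟮θ⟯.toSubfield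

/-- O is an order of the field K: a subring of K which is a finitely generated additive
group containing a ℚ-basis of K. -/
structure IsOrder (K : Subfield ℂ) (O : Subring ℂ) : Prop where
  le : (O : Set ℂ) ⊆ (K : Set ℂ)
  fg : O.toAddSubgroup.FG
  full : ∀ x ∈ K, ∃ n : ℤ, n ≠ 0 ∧ (n : ℂ) * x ∈ O

/-- The lattice spanned by a and b. -/
def zLat (a b : ℂ) : AddSubgroup ℂ := AddSubgroup.closure {a, b}

/-- (a,b) is a ℤ-basis (with Im(a/b) > 0) of a proper (characteristic) ideal of the
order O of K: the lattice ℤa+ℤb lies in K and its multiplier ring is exactly O. -/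
def IsIdealBasis (K : Subfield ℂ) (O : Subring ℂ) (a b : ℂ) : Prop :=
  0 < (a / b).im ∧ a ∈ K ∧ b ∈ K ∧
  ∀ lam : ℂ, lam ∈ O ↔ (lam * a ∈ zLat a b ∧ lam * b ∈ zLat a b)

/-- Two lattices differ by a nonzero scalar factor. -/
def LatEquiv (A B : AddSubgroup ℂ) : Prop :=
  ∃ μ : ℂ, μ ≠ 0 ∧ (B : Set ℂ) = (fun z => μ * z) '' (A : Set ℂ)

/-- The two ideals with the given bases lie in the same ideal class. -/
def IdealEquiv (a b a' b' : ℂ) : Prop := LatEquiv (zLat a b) (zLat a' b')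

/-- Product of two lattices. -/
def latMul (A B : AddSubgroup ℂ) : AddSubgroup ℂ :=
  AddSubgroup.closure {z : ℂ | ∃ x ∈ A, ∃ y ∈ B, z = x * y}

/-- μ is a primitive element of the order O : μ ∈ O and μ/t ∉ O for every integer t > 1. -/
def IsPrimElem (O : Subring ℂ) (μ : ℂ) : Prop :=
  μ ∈ O ∧ ∀ t : ℤ, 1 < t → μ / (t : ℂ) ∉ O

/-- μ and μ' are associated in O (differ by a unit of O). -/
def UnitAssoc (O : Subring ℂ) (μ μ' : ℂ) : Prop :=
  ∃ ε : ℂ, ε ∈ O ∧ ε ≠ 0 ∧ ε⁻¹ ∈ O ∧ μ' = ε * μ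

/-- The ring of integers of a subfield K of ℂ, as a subring of ℂ. -/
def OK (K : Subfield ℂ) : Subring ℂ := (integralClosure ℤ ℂ).toSubring ⊓ K.toSubring

/-- The index of an order O in the maximal order of K (for a quadratic field this
equals the conductor f of O). -/
def condIndex (K : Subfield ℂ) (O : Subring ℂ) : ℕ :=
  (O.toAddSubgroup.addSubgroupOf (OK K).toAddSubgroup).index

/-- The lattice in ℂ attached to an ideal of the maximal order of K. -/
def idealLat (K : Subfield ℂ) (I : Ideal ↥(OK K)) : AddSubgroup ℂ :=
  AddSubgroup.closure {z : ℂ | ∃ x ∈ I, (x : ℂ) = z}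

/-- The lattice attached to the O-ideal I ∩ O, for an ideal I of the maximal order. -/
def primeOrderLat (K : Subfield ℂ) (O : Subring ℂ) (I : Ideal ↥(OK K)) : AddSubgroup ℂ :=
  AddSubgroup.closure {z : ℂ | z ∈ O ∧ ∃ x ∈ I, (x : ℂ) = z}

/-- The set of all class invariants j(k) of ideal classes of the order O. -/
def classInvSet (K : Subfield ℂ) (O : Subring ℂ) : Set ℂ :=
  {w : ℂ | ∃ a b : ℂ, IsIdealBasis K O a b ∧ w = jC (a / b)}

/-- The ring class field Ω_R : the subfield of ℂ generated by K together with all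
class invariants of the order O. -/
def ringClassField (K : Subfield ℂ) (O : Subring ℂ) : Subfield ℂ :=
  Subfield.closure ((K : Set ℂ) ∪ classInvSet K O)

theorem le_ringClassField (K : Subfield ℂ) (O : Subring ℂ) : K ≤ ringClassField K O :=
  fun _ hx => Subfield.subset_closure (Set.mem_union_left _ hx)

noncomputable instance rcfAlgebra (K : Subfield ℂ) (O : Subring ℂ) :
    Algebra ↥K ↥(ringClassField K O) :=
  (Subfield.inclusion (le_ringClassField K O)).toAlgebra

theorem OK_mono {K L : Subfield ℂ} (h : K ≤ L) : OK K ≤ OK L := by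
  intro x hx
  rw [OK, Subring.mem_inf] at hx ⊢
  exact ⟨hx.1, h hx.2⟩

/-- 𝔭 splits completely in L/K: the extension of 𝔭 to the ring of integers of L is a
product of pairwise distinct primes, each of residue degree one over 𝔭. -/
def SplitsCompletely (K L : Subfield ℂ) (h : K ≤ L) (p : Ideal ↥(OK K)) : Prop :=
  ∃ (g : ℕ) (Q : Fin g → Ideal ↥(OK L)),
    Function.Injective Q ∧ (∀ i, (Q i).IsPrime) ∧
    Ideal.map (Subring.inclusion (OK_mono h)) p = ∏ i, Q i ∧
    ∀ i, Nat.card (↥(OK L) ⧸ Q i) = Nat.card (↥(OK K) ⧸ p)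

/-- L is a finite extension of ℚ (a number field) inside ℂ. -/
def FinDimOverQ (L : Subfield ℂ) : Prop :=
  ∃ t : Finset ℂ, (L : Set ℂ) ⊆ (Submodule.span ℚ (t : Set ℂ) : Submodule ℚ ℂ)

/-- Lattice Eisenstein sums Σ_{w∈L, w≠0} w^{-k}. -/
def gkL (k : ℕ) (L : AddSubgroup ℂ) : ℂ :=
  ∑' w : {w : ℂ // w ∈ L ∧ w ≠ 0}, (w : ℂ) ^ (-(k : ℤ))

def g2L (L : AddSubgroup ℂ) : ℂ := 60 * gkL 4 L
def g3L (L : AddSubgroup ℂ) : ℂ := 140 * gkL 6 L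
def discL (L : AddSubgroup ℂ) : ℂ := g2L L ^ 3 - 27 * g3L L ^ 2

/-- The Weierstrass ℘-function of a lattice. -/
def wpL (z : ℂ) (L : AddSubgroup ℂ) : ℂ :=
  z ^ (-2 : ℤ) + ∑' w : {w : ℂ // w ∈ L ∧ w ≠ 0},
    ((z - (w : ℂ)) ^ (-2 : ℤ) - (w : ℂ) ^ (-2 : ℤ))

/-- The Weber function τ_R(z, 𝔴), where e is the number of units of R. -/
def weber (e : ℕ) (z : ℂ) (L : AddSubgroup ℂ) : ℂ :=
  if e = 4 then 2 ^ 8 * 3 ^ 4 * (g2L L ^ 2 / discL L) * wpL z L ^ 2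
  else if e = 6 then -(2 ^ 9 * 3 ^ 6) * (g3L L / discL L) * wpL z L ^ 3
  else -(2 ^ 7 * 3 ^ 5) * (g2L L * g3L L / discL L) * wpL z L

/-- The number of units (roots of unity) in the ring of integers of K. -/
def numRootsOfUnity (K : Subfield ℂ) : ℕ :=
  Nat.card {x : ℂ // x ∈ OK K ∧ ∃ n : ℕ, 0 < n ∧ x ^ n = 1}

/-- λ ≡ 1 mod* 𝔪 (multiplicative congruence): λ = β/γ with β, γ integral and prime
to 𝔪 and β ≡ γ mod 𝔪. -/
def MulCongOne (K : Subfield ℂ) (m : Ideal ↥(OK K)) (lam : ℂ) : Prop :=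
  ∃ β γ : ↥(OK K), (γ : ℂ) ≠ 0 ∧ lam = (β : ℂ) / (γ : ℂ) ∧
    Ideal.span {β} ⊔ m = ⊤ ∧ Ideal.span {γ} ⊔ m = ⊤ ∧ β - γ ∈ m

/-- The Dedekind eta function. -/
def dedekindEta (z : ℂ) : ℂ :=
  Complex.exp (Real.pi * Complex.I * z / 12) *
    ∏' n : ℕ, (1 - Complex.exp (2 * Real.pi * Complex.I * ((n : ℂ) + 1) * z))

/-- ζ₂₄ = e^{2πi/24}. -/
def zeta24 : ℂ := Complex.exp (2 * Real.pi * Complex.I / 24)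

/-- The image of the basis (a,b) under an integer matrix. -/
def matBasis (P : Mat) (a b : ℂ) : ℂ × ℂ :=
  ((P 0 0 : ℂ) * a + (P 0 1 : ℂ) * b, (P 1 0 : ℂ) * a + (P 1 1 : ℂ) * b)

/-- The image of the basis (a,b) under a rational matrix. -/
def matBasisQ (B : Matrix (Fin 2) (Fin 2) ℚ) (a b : ℂ) : ℂ × ℂ :=
  ((B 0 0 : ℂ) * a + (B 0 1 : ℂ) * b, (B 1 0 : ℂ) * a + (B 1 1 : ℂ) * b)

/-- φ_B for a rational matrix B of positive determinant. -/
def phiQ (B : Matrix (Fin 2) (Fin 2) ℚ) (z : ℂ) : ℂ :=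
  (B.det : ℂ) ^ 12 *
      discC (((B 0 0 : ℂ) * z + (B 0 1 : ℂ)) / ((B 1 0 : ℂ) * z + (B 1 1 : ℂ))) /
    (((B 1 0 : ℂ) * z + (B 1 1 : ℂ)) ^ 12 * discC z)

/-- The lattice attached to the complex conjugate of an ideal of the maximal order. -/
def conjIdealLat (K : Subfield ℂ) (I : Ideal ↥(OK K)) : AddSubgroup ℂ :=
  AddSubgroup.closure {z : ℂ | ∃ x ∈ I, (starRingEnd ℂ) (x : ℂ) = z}

/-- The triangular representatives (a b; 0 d), a·d = s, gcd(a,b,d) = 1, 0 ≤ b < d,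
encoded as triples (a, b, d). -/
def triReps (s : ℕ) : Finset (ℕ × ℕ × ℕ) :=
  (Finset.range (s + 1) ×ˢ Finset.range (s + 1) ×ˢ Finset.range (s + 1)).filter
    (fun t => 0 < t.1 ∧ 0 < t.2.2 ∧ t.1 * t.2.2 = s ∧
      Nat.gcd t.1 (Nat.gcd t.2.1 t.2.2) = 1 ∧ t.2.1 < t.2.2)
section ModularPolynomial

open UpperHalfPlane hiding I
open Function Filter Topology
open scoped MatrixGroups Manifold

theorem qParam_add (h : ℝ) (z w : ℂ) :
    Periodic.qParam h (z + w) = Periodic.qParam h z * Periodic.qParam h w := by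
  simp only [Periodic.qParam, ← Complex.exp_add]
  ring_nf

theorem qParam_self {h : ℝ} (hh : h ≠ 0) : Periodic.qParam h h = 1 := by
  have : (h : ℂ) ≠ 0 := by exact_mod_cast hh
  rw [Periodic.qParam, mul_div_assoc, div_self this, mul_one, exp_two_pi_mul_I]

theorem qParam_one_eq_pow {s : ℕ} (hs : 1 ≤ s) (z : ℂ) :
    Periodic.qParam 1 z = Periodic.qParam s z ^ s := by
  have hs0 : (s : ℂ) ≠ 0 := by exact_mod_cast (by lia : s ≠ 0)
  rw [Periodic.qParam, Periodic.qParam, ← Complex.exp_nat_mul]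
  congr 1
  push_cast
  field_simp

/-- `f` is given on the upper half-plane by the convergent expansion `∑ Pₙ·e^{2πinτ/h}`. -/
def HasQExp (h : ℝ) (f : ℍ → ℂ) (P : PowerSeries ℂ) : Prop :=
  ∀ τ : ℍ, HasSum (fun n : ℕ ↦ P.coeff n * Periodic.qParam h τ ^ n) (f τ)

namespace HasQExp

variable {h : ℝ} {f g : ℍ → ℂ} {P Q : PowerSeries ℂ}

theorem add (hf : HasQExp h f P) (hg : HasQExp h g Q) : HasQExp h (f + g) (P + Q) := by
  intro τ
  simpa [add_mul] using (hf τ).add (hg τ)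

theorem const_mul (hf : HasQExp h f P) (c : ℂ) :
    HasQExp h (fun τ ↦ c * f τ) (PowerSeries.C c * P) := by
  intro τ
  simpa [mul_assoc] using (hf τ).mul_left c

theorem sub (hf : HasQExp h f P) (hg : HasQExp h g Q) : HasQExp h (f - g) (P - Q) := by
  intro τ
  simpa [sub_mul] using (hf τ).sub (hg τ)

theorem mul (hf : HasQExp h f P) (hg : HasQExp h g Q) : HasQExp h (f * g) (P * Q) := by
  intro τ
  have hf' := (hf τ).summable.norm
  have hg' := (hg τ).summable.norm
  have key : ∀ n : ℕ, (P * Q).coeff n * Periodic.qParam h τ ^ n =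
      ∑ kl ∈ Finset.HasAntidiagonal.antidiagonal n, (P.coeff kl.1 * Periodic.qParam h τ ^ kl.1) *
        (Q.coeff kl.2 * Periodic.qParam h τ ^ kl.2) := by
    intro n
    rw [PowerSeries.coeff_mul, Finset.sum_mul]
    refine Finset.sum_congr rfl fun kl hkl ↦ ?_
    rw [← Finset.HasAntidiagonal.mem_antidiagonal.mp hkl, pow_add]
    ring
  simp_rw [key]
  have := (summable_norm_sum_mul_antidiagonal_of_summable_norm hf' hg').of_norm.hasSum
  rwa [← tsum_mul_tsum_eq_tsum_sum_antidiagonal_of_summable_norm hf' hg',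
    (hf τ).tsum_eq, (hg τ).tsum_eq] at this

theorem const (h : ℝ) (c : ℂ) : HasQExp h (fun _ ↦ c) (PowerSeries.C c) := by
  intro τ
  convert! hasSum_ite_eq (0 : ℕ) c using 2 with n
  rcases n with _ | n <;> simp [PowerSeries.coeff_C]

theorem one (h : ℝ) : HasQExp h 1 1 := by
  simpa using! const h 1

theorem qParam_pow (h : ℝ) (m : ℕ) :
    HasQExp h (fun τ ↦ Periodic.qParam h τ ^ m) (PowerSeries.X ^ m) := by
  intro τ
  convert! hasSum_ite_eq m (Periodic.qParam h τ ^ m) using 2 with n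
  by_cases hn : n = m <;> simp [PowerSeries.coeff_X_pow, hn]

theorem sum {ι : Type*} (s : Finset ι) {f : ι → ℍ → ℂ} {P : ι → PowerSeries ℂ}
    (H : ∀ i ∈ s, HasQExp h (f i) (P i)) : HasQExp h (∑ i ∈ s, f i) (∑ i ∈ s, P i) := by
  intro τ
  simpa [Finset.sum_mul] using hasSum_sum (fun i hi ↦ H i hi τ)

theorem pow (hf : HasQExp h f P) (m : ℕ) : HasQExp h (f ^ m) (P ^ m) := by
  induction m with
  | zero => simpa using one h
  | succ m ih => simpa [pow_succ] using ih.mul hf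

theorem periodic (hf : HasQExp h f P) (hh : 0 < h) : Periodic (f ∘ ofComplex) h := by
  intro w
  by_cases hw : 0 < w.im
  · have hw' : 0 < (w + h).im := by simpa using hw
    simp only [comp_apply]
    have h1 := hf (ofComplex (w + h))
    have h2 := hf (ofComplex w)
    rw [ofComplex_apply_of_im_pos hw] at h2
    rw [ofComplex_apply_of_im_pos hw'] at h1
    simp only [qParam_add, qParam_self hh.ne', mul_one] at h1
    rw [ofComplex_apply_of_im_pos hw, ofComplex_apply_of_im_pos hw']
    exact h1.unique h2
  · have hw' : ¬ 0 < (w + h).im := by simpa using hw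
    simp only [comp_apply]
    rw [ofComplex_apply_of_im_nonpos (not_lt.mp hw), ofComplex_apply_of_im_nonpos (not_lt.mp hw')]

theorem mdifferentiable (hf : HasQExp h f P) (hh : 0 < h) : MDiff f := by
  rw [UpperHalfPlane.mdifferentiable_iff]
  intro z hz
  apply DifferentiableAt.differentiableWithinAt
  have hz0 : 0 < z.im := hz
  set y : ℝ := z.im / 2 with hy
  have hy0 : 0 < y := by positivity
  set t : ℍ := ⟨y * I, by simpa using hy0⟩ with ht
  have hopen : IsOpen {w : ℂ | y < w.im} := isOpen_lt continuous_const continuous_im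
  have hd : DifferentiableOn ℂ (fun w : ℂ ↦ ∑' n : ℕ, P.coeff n * Periodic.qParam h w ^ n)
      {w : ℂ | y < w.im} := by
    refine differentiableOn_tsum_of_summable_norm (hf t).summable.norm (fun n ↦ ?_) hopen ?_
    · exact (((Periodic.differentiable_qParam (h := h)).pow n).const_mul _).differentiableOn
    · intro n w hw
      rw [norm_mul, norm_mul, norm_pow, norm_pow]
      gcongr
      rw [Periodic.norm_qParam, Periodic.norm_qParam]
      have : y < w.im := hw
      apply Real.exp_le_exp.mpr
      have h3 : (t : ℂ).im ≤ w.im := by simpa [ht] using this.le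
      have : 2 * Real.pi * (t : ℂ).im / h ≤ 2 * Real.pi * w.im / h := by gcongr
      simp only [neg_mul, neg_div]
      linarith
  have hzm : {w : ℂ | y < w.im} ∈ 𝓝 z := hopen.mem_nhds (by simp [hy]; linarith)
  refine (hd.differentiableAt hzm).congr_of_eventuallyEq ?_
  filter_upwards [hzm] with w hw
  have hw0 : 0 < w.im := hy0.trans hw
  simp only [comp_apply]
  rw [ofComplex_apply_of_im_pos hw0]
  exact (hf ⟨w, hw0⟩).tsum_eq.symm

theorem isBoundedAtImInfty (hf : HasQExp h f P) (hh : 0 < h) : IsBoundedAtImInfty f :=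
  isBoundedAtImInfty_of_hasSum_qExpansion hh (c := fun n ↦ P.coeff n)
    fun τ ↦ by simpa using! hf τ

theorem of_periodic (hh : 0 < h) (hper : Periodic (f ∘ ofComplex) h) (hd : MDiff f)
    (hb : IsBoundedAtImInfty f) : HasQExp h f (qExpansion h f) :=
  fun τ ↦ by simpa using! hasSum_qExpansion hh hper hd hb τ

theorem hasFPowerSeriesAt (hf : HasQExp h f P) (hh : 0 < h) :
    HasFPowerSeriesAt (cuspFunction h f) (.ofScalars ℂ fun n ↦ P.coeff n) 0 :=
  (hasFPowerSeriesOnBall_cuspFunction hh (analyticAt_cuspFunction_zero hh (hf.periodic hh)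
    (hf.mdifferentiable hh) (hf.isBoundedAtImInfty hh))
    (fun τ ↦ by simpa using! hf τ)).hasFPowerSeriesAt

theorem unique (hf : HasQExp h f P) (hg : HasQExp h f Q) (hh : 0 < h) : P = Q := by
  ext n
  simpa using congr_arg (FormalMultilinearSeries.coeff · n)
    ((hf.hasFPowerSeriesAt hh).eq_formalMultilinearSeries (hg.hasFPowerSeriesAt hh))

theorem tendsto_atImInfty (hf : HasQExp h f P) (hh : 0 < h) :
    Tendsto f atImInfty (𝓝 (P.coeff 0)) := by
  have hcont := (hf.hasFPowerSeriesAt hh).continuousAt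
  have h0 : P.coeff 0 = cuspFunction h f 0 := by
    simpa using (hf.hasFPowerSeriesAt hh).coeff_zero 1
  have := hcont.tendsto.comp (qParam_tendsto_atImInfty hh)
  rw [← h0] at this
  exact this.congr fun τ ↦ eq_cuspFunction τ hh.ne' (hf.periodic hh)

/-- A common factor `e^{2πiτ/h}` may be cancelled from an expansion without constant term. -/
theorem of_qParam_mul (hf : HasQExp h (fun τ ↦ Periodic.qParam h τ * f τ) P)
    (h0 : P.coeff 0 = 0) : HasQExp h f (PowerSeries.mk fun n ↦ P.coeff (n + 1)) := by
  intro τ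
  have h1 := (hasSum_nat_add_iff' 1).mpr (hf τ)
  have hq : Periodic.qParam h (τ : ℂ) ≠ 0 := Periodic.qParam_ne_zero _
  have h2 := h1.mul_left (Periodic.qParam h τ)⁻¹
  convert! h2 using 2
  · rw [PowerSeries.coeff_mk, pow_succ]
    field_simp
  · simp only [Finset.range_one, Finset.sum_singleton, h0]
    field_simp
    ring

end HasQExp

open ModularForm EisensteinSeries

/-- The normalised modular invariant `E₄³/Δ` on the upper half-plane. -/
def kleinJ (τ : ℍ) : ℂ := E₄ τ ^ 3 / ModularForm.discriminant τ

theorem tsum_lattice_eq_E {k : ℕ} (hk : 3 ≤ k) (τ : ℍ) :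
    ∑' w : {v : ℤ × ℤ // v ≠ 0}, ((w.1.1 : ℂ) * τ + (w.1.2 : ℂ)) ^ (-(k : ℤ)) =
      2 * riemannZeta k * E hk τ := by
  have h1 : ∑' v : Fin 2 → ℤ, eisSummand k v τ = 2 * riemannZeta k * E hk τ := by
    rw [tsum_eisSummand_eq_riemannZeta_mul_eisensteinSeries hk τ,
      show E hk τ = (1 / 2 : ℂ) • eisensteinSeriesSIF (N := 1) 0 k τ from rfl,
      eisensteinSeriesSIF_apply]
    simp only [smul_eq_mul]
    ring
  rw [← h1, ← (finTwoArrowEquiv ℤ).symm.tsum_eq]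
  refine (tsum_subtype_eq_of_support_subset (s := {v : ℤ × ℤ | v ≠ 0})
    (f := fun v : ℤ × ℤ ↦ ((v.1 : ℂ) * τ + (v.2 : ℂ)) ^ (-(k : ℤ))) ?_).trans ?_
  · intro v hv
    rintro rfl
    have : k ≠ 0 := by lia
    simp [this] at hv
  · simp [eisSummand, finTwoArrowEquiv_symm_apply]

theorem riemannZeta_six : riemannZeta 6 = Real.pi ^ 6 / 945 := by
  have := riemannZeta_two_mul_nat (k := 3) (by norm_num)
  have hb : _root_.bernoulli 6 = 1 / 42 := by decide +kernel
  norm_num [hb, Nat.factorial] at this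
  rw [this]
  ring

theorem g2C_coe (τ : ℍ) : g2C τ = 4 * Real.pi ^ 4 / 3 * E₄ τ := by
  have h := tsum_lattice_eq_E (k := 4) (by norm_num) τ
  have hz := riemannZeta_four
  push_cast at h hz
  rw [hz] at h
  rw [g2C]
  refine (congrArg (fun x ↦ 60 * x) h).trans ?_
  ring

theorem g3C_coe (τ : ℍ) : g3C τ = 8 * Real.pi ^ 6 / 27 * E₆ τ := by
  have h := tsum_lattice_eq_E (k := 6) (by norm_num) τ
  have hz := riemannZeta_six
  push_cast at h hz
  rw [hz] at h
  rw [g3C]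
  refine (congrArg (fun x ↦ 140 * x) h).trans ?_
  ring

theorem jC_coe (τ : ℍ) : jC τ = kleinJ τ := by
  have hΔ := discriminant_eq_E₄_cube_sub_E₆_sq τ
  have hΔ0 := discriminant_ne_zero τ
  have hpi : (Real.pi : ℂ) ≠ 0 := by exact_mod_cast Real.pi_ne_zero
  have hd : discC τ = 64 * Real.pi ^ 12 / 27 * (1728 * ModularForm.discriminant τ) := by
    rw [discC, g2C_coe, g3C_coe, hΔ]
    ring
  rw [jC, kleinJ, hd, g2C_coe]
  field_simp
  ring

theorem slashInvariantForm_smul {F : Type*} [FunLike F ℍ ℂ] {k : ℤ}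
    [SlashInvariantFormClass F 𝒮ℒ k] (f : F) (γ : SL(2, ℤ)) (τ : ℍ) :
    f (γ • τ) = denom γ τ ^ k * f τ := by
  have : SlashInvariantFormClass F (CongruenceSubgroup.Gamma 1) k :=
    CongruenceSubgroup.Gamma_one_coe_eq_SL ▸ ‹_›
  exact SlashInvariantForm.slash_action_eqn_SL'' f (CongruenceSubgroup.mem_Gamma_one γ) τ

theorem kleinJ_smul (γ : SL(2, ℤ)) (τ : ℍ) : kleinJ (γ • τ) = kleinJ τ := by
  have h4 := slashInvariantForm_smul E₄ γ τ
  have h12 := slashInvariantForm_smul CuspForm.discriminant γ τ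
  have hne : denom γ τ ≠ 0 := denom_ne_zero _ _
  have hΔ0 := discriminant_ne_zero τ
  rw [CuspForm.coe_discriminant] at h12
  rw [kleinJ, h4, h12, kleinJ, zpow_ofNat, zpow_ofNat, mul_pow, ← pow_mul]
  exact mul_div_mul_left _ _ (pow_ne_zero _ hne)

/-- The power series `∑ σ₃(n) Xⁿ` -/
def sigmaSeries (k : ℕ) : PowerSeries ℤ := PowerSeries.mk fun n ↦ (ArithmeticFunction.sigma k n : ℤ)

theorem twelve_dvd_sigma (n : ℕ) :
    (12 : ℤ) ∣ 5 * (ArithmeticFunction.sigma 3 n : ℤ) + 7 * (ArithmeticFunction.sigma 5 n : ℤ) := by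
  simp only [ArithmeticFunction.sigma_apply]
  push_cast
  rw [Finset.mul_sum, Finset.mul_sum, ← Finset.sum_add_distrib]
  refine Finset.dvd_sum fun d _ ↦ ?_
  have key : ∀ x : ZMod 12, 5 * x ^ 3 + 7 * x ^ 5 = 0 := by decide
  have := key (d : ZMod 12)
  refine (ZMod.intCast_zmod_eq_zero_iff_dvd _ 12).mp ?_
  push_cast
  exact this

theorem hasQExp_modularForm {k : ℤ} (f : ModularForm 𝒮ℒ k) : HasQExp 1 f (qExpansion 1 f) :=
  fun τ ↦ ModularForm.hasSum_qExpansion f one_pos one_mem_strictPeriods_SL τ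

theorem powerSeries_coeff_ofNat_mul {R : Type*} [CommRing R] (m : ℕ) [m.AtLeastTwo]
    (P : PowerSeries R)
    (n : ℕ) : (OfNat.ofNat m * P : PowerSeries R).coeff n = OfNat.ofNat m * P.coeff n := by
  rw [← map_ofNat (PowerSeries.C (R := R)) m, PowerSeries.coeff_C_mul]

theorem hasQExp_E₄ : HasQExp 1 E₄ ((1 + 240 * sigmaSeries 3).map (Int.castRingHom ℂ)) := by
  convert! hasQExp_modularForm E₄
  ext n
  rw [E_qExpansion_coeff _ ⟨2, rfl⟩, show _root_.bernoulli (2 + 2) = -1 / 30 by decide +kernel]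
  rw [PowerSeries.coeff_map, map_add, powerSeries_coeff_ofNat_mul]
  rcases n with _ | n <;> norm_num [PowerSeries.coeff_one, sigmaSeries]

theorem hasQExp_E₆ : HasQExp 1 E₆ ((1 - 504 * sigmaSeries 5).map (Int.castRingHom ℂ)) := by
  convert! hasQExp_modularForm E₆
  ext n
  rw [E_qExpansion_coeff _ ⟨3, rfl⟩, show _root_.bernoulli (3 + 3) = 1 / 42 by decide +kernel]
  rw [PowerSeries.coeff_map, map_sub, powerSeries_coeff_ofNat_mul]
  rcases n with _ | n <;> norm_num [PowerSeries.coeff_one, sigmaSeries]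

theorem exists_hasQExp_discriminant : ∃ D : PowerSeries ℤ, D.coeff 0 = 0 ∧ D.coeff 1 = 1 ∧
    HasQExp 1 ModularForm.discriminant (D.map (Int.castRingHom ℂ)) := by
  choose w hw using twelve_dvd_sigma
  set A := sigmaSeries 3 with hA
  set B := sigmaSeries 5 with hB
  set W : PowerSeries ℤ := PowerSeries.mk w with hW
  have hABW : 5 * A + 7 * B = 12 * W := by
    ext n
    rw [map_add, powerSeries_coeff_ofNat_mul, powerSeries_coeff_ofNat_mul,
      powerSeries_coeff_ofNat_mul]
    simpa [hA, hB, hW, sigmaSeries] using hw n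
  set D : PowerSeries ℤ := W + 100 * A ^ 2 - 147 * B ^ 2 + 8000 * A ^ 3 with hD
  have h1728 : (1728 : PowerSeries ℤ) * D = (1 + 240 * A) ^ 3 - (1 - 504 * B) ^ 2 := by
    rw [hD]
    linear_combination (-144) * hABW
  have hexp : HasQExp 1 ModularForm.discriminant (D.map (Int.castRingHom ℂ)) := by
    have := ((hasQExp_E₄.pow 3).sub (hasQExp_E₆.pow 2)).const_mul (1 / 1728 : ℂ)
    rw [← map_pow, ← map_pow, ← map_sub, ← h1728, map_mul, ← mul_assoc] at this
    have hc : PowerSeries.C (1 / 1728 : ℂ) * (PowerSeries.map (Int.castRingHom ℂ)) 1728 = 1 := by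
      rw [map_ofNat, ← map_ofNat (PowerSeries.C (R := ℂ)) 1728, ← map_mul]
      norm_num
    rw [hc, one_mul] at this
    convert! this using 1
    ext τ
    rw [discriminant_eq_E₄_cube_sub_E₆_sq]
    simp
    ring
  have hq : D.map (Int.castRingHom ℂ) = qExpansion 1 ModularForm.discriminant :=
    hexp.unique (.of_periodic one_pos (hexp.periodic one_pos) (hexp.mdifferentiable one_pos)
      (hexp.isBoundedAtImInfty one_pos)) one_pos
  refine ⟨D, ?_, ?_, hexp⟩
  · have := CuspFormClass.qExpansion_coeff_zero CuspForm.discriminant one_pos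
      one_mem_strictPeriods_SL
    change (qExpansion 1 ModularForm.discriminant).coeff 0 = 0 at this
    rw [← hq, PowerSeries.coeff_map, eq_intCast] at this
    exact_mod_cast this
  · have := discriminant_qExpansion_coeff_one
    rw [← hq, PowerSeries.coeff_map, eq_intCast] at this
    exact_mod_cast this

/-- `q·j` has an expansion in powers of `q` with integer coefficients and constant term one. -/
theorem exists_hasQExp_qParam_mul_kleinJ : ∃ G : PowerSeries ℤ, G.coeff 0 = 1 ∧
    HasQExp 1 (fun τ ↦ Periodic.qParam 1 τ * kleinJ τ) (G.map (Int.castRingHom ℂ)) := by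
  obtain ⟨D, hD0, hD1, hD⟩ := exists_hasQExp_discriminant
  have hqne : ∀ τ : ℍ, Periodic.qParam 1 (τ : ℂ) ≠ 0 := fun τ ↦ Periodic.qParam_ne_zero _
  set V : PowerSeries ℤ := PowerSeries.mk fun n ↦ D.coeff (n + 1) with hV
  have hVexp : HasQExp 1 (fun τ ↦ ModularForm.discriminant τ / Periodic.qParam 1 τ)
      (V.map (Int.castRingHom ℂ)) := by
    have h := HasQExp.of_qParam_mul (h := 1)
      (f := fun τ ↦ ModularForm.discriminant τ / Periodic.qParam 1 τ)
      (P := D.map (Int.castRingHom ℂ)) ?_ (by simp [hD0])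
    · convert! h using 1
    · convert! hD using 1
      ext τ
      field_simp [hqne τ]
  have hV0 : PowerSeries.constantCoeff V = ((1 : ℤˣ) : ℤ) := by
    rw [← PowerSeries.coeff_zero_eq_constantCoeff_apply]
    simp [hV, hD1]
  set U := PowerSeries.invOfUnit V 1 with hU
  have hVU : V * U = 1 := PowerSeries.mul_invOfUnit V 1 hV0
  have hq1 := HasQExp.qParam_pow 1 1
  simp only [pow_one] at hq1
  have hu : HasQExp 1 (fun τ ↦ Periodic.qParam 1 τ / ModularForm.discriminant τ)
      (qExpansion 1 (fun τ : ℍ ↦ Periodic.qParam 1 τ / ModularForm.discriminant τ)) := by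
    refine .of_periodic one_pos (fun w ↦ ?_) ?_ ?_
    · have h1 := hq1.periodic one_pos w
      have h2 := hD.periodic one_pos w
      simp only [comp_apply] at h1 h2 ⊢
      rw [h1, h2]
    · exact (hq1.mdifferentiable one_pos).div (hD.mdifferentiable one_pos) discriminant_ne_zero
    · have hO : (fun τ : ℍ ↦ Periodic.qParam 1 (τ : ℂ)) =O[atImInfty] ModularForm.discriminant := by
        refine Asymptotics.IsBigO.trans (.of_bound 1 (.of_forall fun τ ↦ ?_))
          exp_isBigO_discriminant
        rw [Periodic.norm_qParam, one_mul, Real.norm_of_nonneg (Real.exp_pos _).le]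
        simp
      rw [IsBoundedAtImInfty, BoundedAtFilter]
      exact (Asymptotics.div_isBoundedUnder_of_isBigO hO).isBigO_one ℝ
  have hprod := (hVexp.mul hu).unique (Q := 1) (by
    convert! HasQExp.one 1 using 1
    ext τ
    have := hqne τ
    have := discriminant_ne_zero τ
    simp only [Pi.mul_apply, Pi.one_apply]
    field_simp) one_pos
  have hUeq : qExpansion 1 (fun τ : ℍ ↦ Periodic.qParam 1 τ / ModularForm.discriminant τ) =
      U.map (Int.castRingHom ℂ) := by
    have h2 : V.map (Int.castRingHom ℂ) * U.map (Int.castRingHom ℂ) = 1 := by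
      rw [← map_mul, hVU, map_one]
    calc _ = (U.map (Int.castRingHom ℂ) * V.map (Int.castRingHom ℂ)) *
        qExpansion 1 (fun τ : ℍ ↦ Periodic.qParam 1 τ / ModularForm.discriminant τ) := by
          rw [mul_comm (U.map _), h2, one_mul]
      _ = _ := by rw [mul_assoc, hprod, mul_one]
  rw [hUeq] at hu
  refine ⟨(1 + 240 * sigmaSeries 3) ^ 3 * U, ?_, ?_⟩
  · have h0 : PowerSeries.constantCoeff U = 1 := by
      have := congrArg PowerSeries.constantCoeff hVU
      rw [map_mul, hV0] at this
      simpa using this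
    rw [PowerSeries.coeff_zero_eq_constantCoeff_apply, map_mul, map_pow, map_add, map_mul, h0]
    simp [sigmaSeries]
  · convert! (hasQExp_E₄.pow 3).mul hu using 1
    · ext τ
      simp only [Pi.mul_apply, Pi.pow_apply, kleinJ]
      ring
    · rw [map_mul, map_pow]

theorem Mat.isPrimitive_iff {S : Mat} :
    S.IsPrimitive ↔ ∀ k : ℕ, (∀ i j, (k : ℤ) ∣ S i j) → k = 1 := by
  rw [Mat.IsPrimitive]
  constructor
  · intro h k hk
    rw [← Nat.dvd_one, ← h]
    simp only [Int.natCast_dvd] at hk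
    exact Nat.dvd_gcd (Nat.dvd_gcd (hk 0 0) (hk 0 1)) (Nat.dvd_gcd (hk 1 0) (hk 1 1))
  · intro h
    refine h _ fun i j ↦ ?_
    rw [Int.natCast_dvd]
    fin_cases i <;> fin_cases j
    · exact (Nat.gcd_dvd_left _ _).trans (Nat.gcd_dvd_left _ _)
    · exact (Nat.gcd_dvd_left _ _).trans (Nat.gcd_dvd_right _ _)
    · exact (Nat.gcd_dvd_right _ _).trans (Nat.gcd_dvd_left _ _)
    · exact (Nat.gcd_dvd_right _ _).trans (Nat.gcd_dvd_right _ _)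

theorem Mat.IsPrimitive.mul_left {S : Mat} (hS : S.IsPrimitive) (M : SL2Z) :
    Mat.IsPrimitive ((M : Mat) * S) := by
  rw [Mat.isPrimitive_iff] at hS ⊢
  intro k hk
  refine hS k fun i j ↦ ?_
  have h : S = ((M⁻¹ : SL2Z) : Mat) * ((M : Mat) * S) := by
    rw [← mul_assoc, ← Matrix.SpecialLinearGroup.coe_mul, inv_mul_cancel]
    simp
  rw [h, Matrix.mul_apply]
  exact Finset.dvd_sum fun l _ ↦ (hk l j).mul_left _

theorem Mat.IsPrimitive.mul_right {S : Mat} (hS : S.IsPrimitive) (M : SL2Z) :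
    Mat.IsPrimitive (S * (M : Mat)) := by
  rw [Mat.isPrimitive_iff] at hS ⊢
  intro k hk
  refine hS k fun i j ↦ ?_
  have h : S = (S * (M : Mat)) * ((M⁻¹ : SL2Z) : Mat) := by
    rw [mul_assoc, ← Matrix.SpecialLinearGroup.coe_mul, mul_inv_cancel]
    simp
  rw [h, Matrix.mul_apply]
  exact Finset.dvd_sum fun l _ ↦ (hk i l).mul_right _

theorem LeftEquiv.symm {S T : Mat} (h : LeftEquiv S T) : LeftEquiv T S := by
  obtain ⟨M, rfl⟩ := h
  refine ⟨M⁻¹, ?_⟩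
  rw [← mul_assoc, ← Matrix.SpecialLinearGroup.coe_mul, inv_mul_cancel]
  simp

theorem LeftEquiv.trans {S T U : Mat} (h : LeftEquiv S T) (h' : LeftEquiv T U) :
    LeftEquiv S U := by
  obtain ⟨M, rfl⟩ := h
  obtain ⟨N, rfl⟩ := h'
  exact ⟨M * N, by rw [Matrix.SpecialLinearGroup.coe_mul, mul_assoc]⟩

/-- Complete systems of representatives of the left orbits, indexed by an arbitrary type. -/
def IsLeftReps (s : ℕ) {ι : Type*} (R : ι → Mat) : Prop :=
  (∀ ν, (R ν).IsPrimitive ∧ (R ν).det = (s : ℤ)) ∧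
  ∀ T : Mat, T.IsPrimitive → T.det = (s : ℤ) → ∃! ν, LeftEquiv T (R ν)

namespace IsLeftReps

variable {s : ℕ} {ι κ : Type*} {R : ι → Mat} {R' : κ → Mat}

theorem exists_equiv (hR : IsLeftReps s R) (hR' : IsLeftReps s R') :
    ∃ e : ι ≃ κ, ∀ ν, LeftEquiv (R ν) (R' (e ν)) := by
  choose e he using fun ν ↦ (hR'.2 (R ν) (hR.1 ν).1 (hR.1 ν).2).exists
  refine ⟨Equiv.ofBijective e ⟨fun i j hij ↦ ?_, fun k ↦ ?_⟩, he⟩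
  · refine (hR.2 (R i) (hR.1 i).1 (hR.1 i).2).unique ⟨1, by simp⟩ ((he i).trans ?_)
    rw [hij]
    exact (he j).symm
  · obtain ⟨i, hi⟩ := (hR.2 (R' k) (hR'.1 k).1 (hR'.1 k).2).exists
    exact ⟨i, (hR'.2 (R i) (hR.1 i).1 (hR.1 i).2).unique (he i) hi.symm⟩

theorem prod_eq {A : Type*} [CommMonoid A] [Fintype ι] [Fintype κ] (hR : IsLeftReps s R)
    (hR' : IsLeftReps s R') {F : Mat → A}
    (hF : ∀ (M : SL2Z) (S : Mat), S.det = (s : ℤ) → F (M * S) = F S) :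
    ∏ i, F (R i) = ∏ k, F (R' k) := by
  obtain ⟨e, he⟩ := hR.exists_equiv hR'
  refine Fintype.prod_equiv e _ _ fun i ↦ ?_
  obtain ⟨M, hM⟩ := he i
  rw [hM, hF _ _ (hR'.1 _).2]

theorem mul_right (hR : IsLeftReps s R) (γ : SL2Z) : IsLeftReps s fun ν ↦ R ν * (γ : Mat) := by
  refine ⟨fun ν ↦ ⟨(hR.1 ν).1.mul_right γ, by simp [(hR.1 ν).2]⟩, fun T hT hdet ↦ ?_⟩
  have key : ∀ ν, LeftEquiv T (R ν * (γ : Mat)) ↔ LeftEquiv (T * ((γ⁻¹ : SL2Z) : Mat)) (R ν) := by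
    intro ν
    constructor
    · rintro ⟨M, rfl⟩
      refine ⟨M, ?_⟩
      rw [mul_assoc, mul_assoc, ← Matrix.SpecialLinearGroup.coe_mul, mul_inv_cancel]
      simp
    · rintro ⟨M, hM⟩
      refine ⟨M, ?_⟩
      rw [← mul_assoc, ← hM, mul_assoc, ← Matrix.SpecialLinearGroup.coe_mul, inv_mul_cancel]
      simp
  simp_rw [key]
  exact hR.2 _ (hT.mul_right _)
    (by rw [Matrix.det_mul, hdet, Matrix.SpecialLinearGroup.det_coe, mul_one])

end IsLeftReps

/-- The triangular matrix encoded by a triple `(a, b, d)`. -/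
def triMat (t : ℕ × ℕ × ℕ) : Mat := !![(t.1 : ℤ), (t.2.1 : ℤ); 0, (t.2.2 : ℤ)]

theorem mem_triReps {s : ℕ} {t : ℕ × ℕ × ℕ} : t ∈ triReps s ↔
    0 < t.1 ∧ 0 < t.2.2 ∧ t.1 * t.2.2 = s ∧ Nat.gcd t.1 (Nat.gcd t.2.1 t.2.2) = 1 ∧
      t.2.1 < t.2.2 := by
  rw [triReps, Finset.mem_filter]
  refine and_iff_right_of_imp ?_
  rintro ⟨h1, h2, h3, -, h4⟩
  simp only [Finset.mem_product, Finset.mem_range, ← h3]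
  refine ⟨?_, ?_, ?_⟩ <;> nlinarith

theorem triMat_isPrimitive_iff (t : ℕ × ℕ × ℕ) :
    (triMat t).IsPrimitive ↔ Nat.gcd t.1 (Nat.gcd t.2.1 t.2.2) = 1 := by
  simp [Mat.IsPrimitive, triMat, Nat.gcd_assoc]

theorem exists_leftEquiv_triMat {s : ℕ} (hs : 1 ≤ s) (T : Mat) (hT : T.IsPrimitive)
    (hdet : T.det = (s : ℤ)) : ∃ t ∈ triReps s, LeftEquiv T (triMat t) := by
  have hred : ∀ A : FixedDetMatrix (Fin 2) ℤ (s : ℤ),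
      ∃ g : SL(2, ℤ), FixedDetMatrices.reduce A = g • A := by
    intro A
    induction A using FixedDetMatrices.reduce_rec with
    | base A h =>
      by_cases ha : 0 < A.1 0 0
      · exact ⟨_, FixedDetMatrices.reduce_of_pos h ha⟩
      · refine ⟨ModularGroup.T ^ (-(-A.1 0 1 / -A.1 1 1)) * (ModularGroup.S * ModularGroup.S), ?_⟩
        rw [FixedDetMatrices.reduce_of_not_pos h ha, ← mul_smul, ← mul_smul, mul_assoc]
    | step A h ih =>
      obtain ⟨g, hg⟩ := ih
      rw [FixedDetMatrices.reduce_reduceStep h] at hg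
      exact ⟨g * (ModularGroup.S * _), by rw [hg, FixedDetMatrices.reduceStep, mul_smul, mul_smul]⟩
  obtain ⟨g, hg⟩ := hred ⟨T, hdet⟩
  obtain ⟨h10, h00, h01, h11⟩ := FixedDetMatrices.reduce_mem_reps (by lia) ⟨T, hdet⟩
  set A := (FixedDetMatrices.reduce ⟨T, hdet⟩) with hA
  have hAT : A.1 = (g : Mat) * T :=
    (congrArg Subtype.val hg).trans (FixedDetMatrices.smul_coe _ _ _ _ _)
  have hd : A.1 0 0 * A.1 1 1 = s := by
    have := A.2
    rw [Matrix.det_fin_two, h10] at this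
    simpa using this
  have hd0 : 0 < A.1 1 1 := by
    refine pos_of_mul_pos_right (a := A.1 0 0) ?_ h00.le
    rw [hd]
    exact_mod_cast hs
  rw [abs_of_nonneg h01, abs_of_pos hd0] at h11
  obtain ⟨a, ha⟩ := Int.eq_ofNat_of_zero_le h00.le
  obtain ⟨b, hb⟩ := Int.eq_ofNat_of_zero_le h01
  obtain ⟨d, hd'⟩ := Int.eq_ofNat_of_zero_le hd0.le
  have hAtri : A.1 = triMat (a, b, d) := by
    ext i j
    fin_cases i <;> fin_cases j <;> simp [triMat, ha, hb, hd', h10]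
  rw [ha, hd'] at hd
  rw [ha] at h00
  rw [hd'] at hd0
  rw [hb, hd'] at h11
  refine ⟨(a, b, d), mem_triReps.mpr ⟨by exact_mod_cast h00, by exact_mod_cast hd0,
    by exact_mod_cast hd, ?_, by exact_mod_cast h11⟩, ?_⟩
  · rw [← triMat_isPrimitive_iff, ← hAtri, hAT]
    exact hT.mul_left g
  · refine LeftEquiv.symm ⟨g, ?_⟩
    rw [← hAtri, hAT]

theorem triMat_leftEquiv_unique {s : ℕ} {t t' : ℕ × ℕ × ℕ} (ht : t ∈ triReps s)
    (ht' : t' ∈ triReps s) (h : LeftEquiv (triMat t) (triMat t')) : t = t' := by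
  obtain ⟨a, b, d⟩ := t
  obtain ⟨a', b', d'⟩ := t'
  rw [mem_triReps] at ht ht'
  obtain ⟨h1, h2, h3, -, h5⟩ := ht
  obtain ⟨h1', h2', h3', -, h5'⟩ := ht'
  simp only at h1 h2 h3 h5 h1' h2' h3' h5'
  obtain ⟨M, hM⟩ := h
  have e00 := congrFun (congrFun hM 0) 0
  have e01 := congrFun (congrFun hM 0) 1
  have e10 := congrFun (congrFun hM 1) 0
  have e11 := congrFun (congrFun hM 1) 1
  have hdet := M.det_coe
  rw [Matrix.det_fin_two] at hdet
  simp only [triMat, Matrix.mul_apply, Fin.sum_univ_two] at e00 e01 e10 e11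
  simp at e00 e01 e10 e11
  have hr : (M : Mat) 1 0 = 0 := by
    rcases e10 with h | h
    · exact h
    · lia
  simp only [hr, zero_mul, zero_add, mul_zero, sub_zero] at e11 hdet
  have hp : (M : Mat) 0 0 = 1 := by
    rcases Int.eq_one_or_neg_one_of_mul_eq_one hdet with h | h
    · exact h
    · rw [h] at e00; lia
  rw [hp] at e00 e01 hdet
  simp only [one_mul] at e00 e01 hdet
  rw [hdet] at e11
  have hdd : d = d' := by lia
  subst hdd
  have haa : a = a' := by lia
  have hbb : b = b' := by
    have h6 : (b : ℤ) % d = (b' : ℤ) % d := by rw [e01]; simp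
    rw [Int.emod_eq_of_lt (by lia) (by lia), Int.emod_eq_of_lt (by lia) (by lia)] at h6
    exact_mod_cast h6
  rw [haa, hbb]

theorem isLeftReps_triReps {s : ℕ} (hs : 1 ≤ s) :
    IsLeftReps s fun t : triReps s ↦ triMat t := by
  refine ⟨fun t ↦ ?_, fun T hT hdet ↦ ?_⟩
  · have := mem_triReps.mp t.2
    refine ⟨(triMat_isPrimitive_iff _).mpr this.2.2.2.1, ?_⟩
    simp only [triMat, Matrix.det_fin_two_of, mul_zero, sub_zero]
    exact_mod_cast this.2.2.1
  · obtain ⟨t, ht, h⟩ := exists_leftEquiv_triMat hs T hT hdet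
    exact ⟨⟨t, ht⟩, h, fun t' h' ↦
      Subtype.ext (triMat_leftEquiv_unique t'.2 ht (h'.symm.trans h))⟩

theorem eq_of_sq_mul_eq_sq_mul {k m k' m' : ℕ} (hk : k ≠ 0) (hk' : k' ≠ 0) (hm : Squarefree m)
    (hm' : Squarefree m') (h : k ^ 2 * m = k' ^ 2 * m') : k = k' := by
  refine Nat.eq_of_factorization_eq hk hk' fun p ↦ ?_
  have h1 := congrArg (fun n ↦ n.factorization p) h
  simp only [Nat.factorization_mul (pow_ne_zero 2 hk) hm.ne_zero,
    Nat.factorization_mul (pow_ne_zero 2 hk') hm'.ne_zero, Nat.factorization_pow] at h1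
  simp at h1
  have h2 := hm.natFactorization_le_one p
  have h3 := hm'.natFactorization_le_one p
  lia

theorem sum_psi_div_sq {s : ℕ} (hs : 1 ≤ s) :
    ∑ k ∈ s.divisors with k ^ 2 ∣ s, psi (s / k ^ 2) = ∑ n ∈ s.divisors, n := by
  have h1 : ∀ n : ℕ, psi n = ∑ m ∈ n.divisors with Squarefree m, n / m := by
    intro n
    rw [psi, Finset.sum_filter]
  simp_rw [h1]
  rw [← Nat.sum_div_divisors s (fun n ↦ n), Finset.sum_sigma']
  refine Finset.sum_bij (fun x _ ↦ x.1 ^ 2 * x.2) ?_ ?_ ?_ ?_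
  · rintro ⟨k, m⟩ h
    simp only [Finset.mem_sigma, Finset.mem_filter, Nat.mem_divisors] at h ⊢
    obtain ⟨⟨⟨-, hs0⟩, u, rfl⟩, ⟨h2, h3⟩, h4⟩ := h
    have hk : 0 < k ^ 2 := Nat.pos_of_ne_zero (left_ne_zero_of_mul hs0)
    rw [Nat.mul_div_cancel_left _ hk] at h2
    exact ⟨mul_dvd_mul_left _ h2, hs0⟩
  · rintro ⟨k, m⟩ h ⟨k', m'⟩ h' heq
    simp only [Finset.mem_sigma, Finset.mem_filter, Nat.mem_divisors] at h h' heq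
    have hk : k ≠ 0 := by rintro rfl; simp at h
    have hk' : k' ≠ 0 := by rintro rfl; simp at h'
    have hkk := eq_of_sq_mul_eq_sq_mul hk hk' h.2.2 h'.2.2 heq
    subst hkk
    rw [Nat.eq_of_mul_eq_mul_left (by positivity) heq]
  · intro n hn
    rw [Nat.mem_divisors] at hn
    obtain ⟨m, k, rfl, hm⟩ := Nat.sq_mul_squarefree n
    obtain ⟨⟨u, rfl⟩, hs0⟩ := hn
    have hk : 0 < k ^ 2 := Nat.pos_of_ne_zero (left_ne_zero_of_mul (left_ne_zero_of_mul hs0))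
    refine ⟨⟨k, m⟩, ?_, rfl⟩
    simp only [Finset.mem_sigma, Finset.mem_filter, Nat.mem_divisors]
    rw [mul_assoc, Nat.mul_div_cancel_left _ hk]
    rw [mul_assoc] at hs0
    exact ⟨⟨⟨⟨k * (m * u), by ring⟩, hs0⟩, dvd_mul_right _ _⟩,
      ⟨dvd_mul_right _ _, right_ne_zero_of_mul hs0⟩, hm⟩
  · rintro ⟨k, m⟩ h
    simp only [Nat.div_div_eq_div_mul]

theorem sum_card_triReps_div_sq {s : ℕ} (hs : 1 ≤ s) :
    ∑ k ∈ s.divisors with k ^ 2 ∣ s, (triReps (s / k ^ 2)).card = ∑ n ∈ s.divisors, n := by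
  have h1 : ∑ n ∈ s.divisors, n = ∑ n ∈ s.divisors, (Finset.range n).card := by simp
  rw [h1, ← Finset.card_sigma, ← Finset.card_sigma]
  refine Finset.card_bij (fun x _ ↦ ⟨x.1 * x.2.2.2, x.1 * x.2.2.1⟩) ?_ ?_ ?_
  · rintro ⟨k, a, b, d⟩ h
    simp only [Finset.mem_sigma, Finset.mem_filter, Nat.mem_divisors, mem_triReps,
      Finset.mem_range] at h ⊢
    obtain ⟨⟨⟨-, hs0⟩, u, rfl⟩, h2, h3, h4, h5, h6⟩ := h
    have hk : 0 < k ^ 2 := Nat.pos_of_ne_zero (left_ne_zero_of_mul hs0)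
    rw [Nat.mul_div_cancel_left _ hk] at h4
    subst h4
    exact ⟨⟨⟨k * a, by ring⟩, hs0⟩,
      Nat.mul_lt_mul_of_pos_left h6 (Nat.pos_of_ne_zero (by rintro rfl; simp at hk))⟩
  · rintro ⟨k, a, b, d⟩ h ⟨k', a', b', d'⟩ h' heq
    simp only [Finset.mem_sigma, Finset.mem_filter, Nat.mem_divisors, mem_triReps,
      Sigma.mk.injEq, heq_eq_eq] at h h' heq
    obtain ⟨⟨⟨-, hs0⟩, u, hu⟩, h2, h3, h4, h5, h6⟩ := h
    obtain ⟨⟨-, u', hu'⟩, h2', h3', h4', h5', h6'⟩ := h'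
    have hk : 0 < k := Nat.pos_of_ne_zero (by rintro rfl; simp [hu] at hs0)
    have hk' : 0 < k' := Nat.pos_of_ne_zero (by rintro rfl; simp [hu'] at hs0)
    rw [hu, Nat.mul_div_cancel_left _ (by positivity)] at h4
    rw [hu', Nat.mul_div_cancel_left _ (by positivity)] at h4'
    subst h4 h4'
    obtain ⟨e1, e2⟩ := heq
    have e3 : k * a = k' * a' := by
      have : (k * d) * (k * a) = (k * d) * (k' * a') := by
        calc _ = s := by rw [hu]; ring
          _ = (k' * d') * (k' * a') := by rw [hu']; ring
          _ = _ := by rw [e1]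
      exact Nat.eq_of_mul_eq_mul_left (by positivity) this
    have hkk : k = k' := by
      have g1 : Nat.gcd (k * a) (Nat.gcd (k * b) (k * d)) = k := by
        rw [Nat.gcd_mul_left, Nat.gcd_mul_left, h5, mul_one]
      have g2 : Nat.gcd (k' * a') (Nat.gcd (k' * b') (k' * d')) = k' := by
        rw [Nat.gcd_mul_left, Nat.gcd_mul_left, h5', mul_one]
      rw [← g1, ← g2, e1, e2, e3]
    subst hkk
    rw [Nat.eq_of_mul_eq_mul_left hk e1, Nat.eq_of_mul_eq_mul_left hk e2,
      Nat.eq_of_mul_eq_mul_left hk e3]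
  · rintro ⟨n, b⟩ h
    simp only [Finset.mem_sigma, Nat.mem_divisors, Finset.mem_range] at h
    obtain ⟨⟨⟨m, hm⟩, hs0⟩, hb⟩ := h
    have hm0 : 0 < m := Nat.pos_of_ne_zero (by rintro rfl; simp [hm] at hs0)
    have hn0 : 0 < n := by lia
    set k := Nat.gcd m (Nat.gcd b n) with hk
    have hk0 : 0 < k := Nat.gcd_pos_of_pos_left _ hm0
    obtain ⟨a, ha⟩ : k ∣ m := Nat.gcd_dvd_left _ _
    obtain ⟨c, hc⟩ : k ∣ b := (Nat.gcd_dvd_right _ _).trans (Nat.gcd_dvd_left _ _)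
    obtain ⟨d, hd⟩ : k ∣ n := (Nat.gcd_dvd_right _ _).trans (Nat.gcd_dvd_right _ _)
    have hg : Nat.gcd a (Nat.gcd c d) = 1 := by
      have : k * Nat.gcd a (Nat.gcd c d) = k * 1 := by
        rw [← Nat.gcd_mul_left, ← Nat.gcd_mul_left, ← ha, ← hc, ← hd, mul_one]
      exact Nat.eq_of_mul_eq_mul_left hk0 this
    have hs' : s = k ^ 2 * (a * d) := by rw [hm, ha, hd]; ring
    refine ⟨⟨k, a, c, d⟩, ?_, by simp only [← hc, ← hd]⟩
    simp only [Finset.mem_sigma, Finset.mem_filter, Nat.mem_divisors, mem_triReps]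
    refine ⟨⟨⟨⟨k * (a * d), by rw [hs']; ring⟩, hs0⟩, ⟨_, hs'⟩⟩, ?_, ?_, ?_, hg, ?_⟩
    · exact Nat.pos_of_ne_zero (by rintro rfl; simp at ha; lia)
    · exact Nat.pos_of_ne_zero (by rintro rfl; simp at hd; lia)
    · rw [hs', Nat.mul_div_cancel_left _ (by positivity)]
    · rw [hc, hd] at hb
      exact Nat.lt_of_mul_lt_mul_left hb

theorem card_triReps {s : ℕ} (hs : 1 ≤ s) : (triReps s).card = psi s := by
  induction s using Nat.strong_induction_on with
  | _ s ih =>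
    have h := (sum_card_triReps_div_sq hs).trans (sum_psi_div_sq hs).symm
    have h1 : 1 ∈ {k ∈ s.divisors | k ^ 2 ∣ s} := by simp; lia
    rw [← Finset.add_sum_erase _ _ h1, ← Finset.add_sum_erase _ _ h1] at h
    simp only [one_pow, Nat.div_one] at h
    refine Nat.add_right_cancel (h.trans ?_)
    congr 1
    refine Finset.sum_congr rfl fun k hk ↦ ?_
    simp only [Finset.mem_erase, Finset.mem_filter, Nat.mem_divisors] at hk
    obtain ⟨hk1, ⟨-, hs0⟩, hks⟩ := hk
    have hk0 : k ≠ 0 := by rintro rfl; simp at hks; lia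
    refine (ih _ (Nat.div_lt_self hs ?_) ?_).symm
    · nlinarith [show 2 ≤ k by lia]
    · exact Nat.div_pos (Nat.le_of_dvd hs hks) (by positivity)

theorem moeb_denom_ne_zero {S : Mat} (hS : 0 < S.det) {z : ℂ} (hz : 0 < z.im) :
    (S 1 0 : ℂ) * z + (S 1 1 : ℂ) ≠ 0 := by
  intro h
  have him := congrArg Complex.im h
  have hre := congrArg Complex.re h
  simp at him hre
  rw [Matrix.det_fin_two] at hS
  have hc : S 1 0 = 0 := him.resolve_right hz.ne'
  have hd : S 1 1 = 0 := by
    simpa [hc] using hre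
  simp [hc, hd] at hS

theorem moeb_im {S : Mat} (z : ℂ) :
    (moeb S z).im = S.det * z.im / Complex.normSq ((S 1 0 : ℂ) * z + (S 1 1 : ℂ)) := by
  rw [moeb, Complex.div_im, Matrix.det_fin_two]
  simp
  ring

theorem moeb_im_pos {S : Mat} (hS : 0 < S.det) {z : ℂ} (hz : 0 < z.im) : 0 < (moeb S z).im := by
  rw [moeb_im]
  have := Complex.normSq_pos.mpr (moeb_denom_ne_zero hS hz)
  have : (0 : ℝ) < S.det := by exact_mod_cast hS
  positivity

theorem moeb_mul {A B : Mat} (hB : 0 < B.det) {z : ℂ} (hz : 0 < z.im) :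
    moeb (A * B) z = moeb A (moeb B z) := by
  have hd := moeb_denom_ne_zero hB hz
  simp only [moeb, Matrix.mul_apply, Fin.sum_univ_two]
  push_cast
  have h1 : ∀ p q : ℂ, p * (((B 0 0 : ℂ) * z + B 0 1) / ((B 1 0 : ℂ) * z + B 1 1)) + q =
      (p * ((B 0 0 : ℂ) * z + B 0 1) + q * ((B 1 0 : ℂ) * z + B 1 1)) /
        ((B 1 0 : ℂ) * z + B 1 1) := by
    intro p q
    rw [eq_div_iff hd, add_mul, mul_assoc, div_mul_cancel₀ _ hd]
  rw [h1, h1, div_div_div_cancel_right₀ hd]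
  congr 1 <;> ring

theorem moeb_coe (γ : SL2Z) (τ : ℍ) : moeb (γ : Mat) τ = ((γ • τ : ℍ) : ℂ) := by
  rw [UpperHalfPlane.coe_specialLinearGroup_apply]
  simp [moeb]

theorem jC_moeb_mul_left (M : SL2Z) {S : Mat} (hS : 0 < S.det) {z : ℂ} (hz : 0 < z.im) :
    jC (moeb (M * S) z) = jC (moeb S z) := by
  rw [moeb_mul hS hz]
  obtain ⟨τ, hτ⟩ : ∃ τ : ℍ, (τ : ℂ) = moeb S z := ⟨⟨_, moeb_im_pos hS hz⟩, rfl⟩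
  rw [← hτ, moeb_coe, jC_coe, jC_coe, kleinJ_smul]

/-- The polynomial with roots `j(Sτ)`, where `S` runs over the triangular representatives. -/
def triPoly (s : ℕ) (z : ℂ) : ℂ[X] := ∏ t ∈ triReps s, (X - C (jC (moeb (triMat t) z)))

theorem IsLeftReps.prod_eq_triPoly {s : ℕ} (hs : 1 ≤ s) {ι : Type*} [Fintype ι] {R : ι → Mat}
    (hR : IsLeftReps s R) {z : ℂ} (hz : 0 < z.im) :
    ∏ ν, (X - C (jC (moeb (R ν) z))) = triPoly s z := by
  rw [triPoly, ← Finset.prod_coe_sort (triReps s)]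
  refine hR.prod_eq (F := fun S ↦ X - C (jC (moeb S z))) (isLeftReps_triReps hs) fun M S hS ↦ ?_
  have : 0 < S.det := by rw [hS]; exact_mod_cast hs
  simp only [jC_moeb_mul_left M this hz]

theorem triPoly_smul {s : ℕ} (hs : 1 ≤ s) (γ : SL2Z) (τ : ℍ) :
    triPoly s (γ • τ : ℍ) = triPoly s τ := by
  rw [← ((isLeftReps_triReps hs).mul_right γ).prod_eq_triPoly hs τ.im_pos, triPoly,
    ← Finset.prod_coe_sort (triReps s)]
  refine Finset.prod_congr rfl fun t _ ↦ ?_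
  rw [moeb_mul (by simp) τ.im_pos, moeb_coe]

theorem HasQExp.eq_const_of_invariant {f : ℍ → ℂ} {P : PowerSeries ℂ} (hf : HasQExp 1 f P)
    (hinv : ∀ (γ : SL(2, ℤ)) (τ : ℍ), f (γ • τ) = f τ) (τ : ℍ) : f τ = P.coeff 0 := by
  have hslash : ∀ γ : SL(2, ℤ), f ∣[(0 : ℤ)] γ = f := by
    intro γ
    ext τ
    rw [SL_slash_apply, hinv]
    simp
  let F : ModularForm 𝒮ℒ 0 :=
    { toFun := f
      slash_action_eq' := fun _ ⟨γ, hγ⟩ ↦ hγ ▸ hslash γ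
      holo' := hf.mdifferentiable one_pos
      bdd_at_cusps' := by
        intro c hc
        rw [Subgroup.IsArithmetic.isCusp_iff_isCusp_SL2Z] at hc
        rw [OnePoint.isBoundedAt_iff_forall_SL2Z hc]
        intro γ _
        rw [hslash γ]
        exact hf.isBoundedAtImInfty one_pos }
  obtain ⟨c, hc⟩ := ModularFormClass.levelOne_weight_zero_const F
  have hfc : f = fun _ ↦ c := hc
  have h1 := hf.unique (hfc ▸ HasQExp.const 1 c) one_pos
  rw [h1, hfc]
  simp

/-- A modular function which is holomorphic on the upper half-plane, meromorphic at infinity and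
has an integral expansion is an integral polynomial in `j`. -/
theorem exists_polynomial_kleinJ (M : ℕ) (f : ℍ → ℂ) (P : PowerSeries ℤ)
    (hf : HasQExp 1 (fun τ ↦ Periodic.qParam 1 τ ^ M * f τ) (P.map (Int.castRingHom ℂ)))
    (hinv : ∀ (γ : SL(2, ℤ)) (τ : ℍ), f (γ • τ) = f τ) :
    ∃ p : ℤ[X], ∀ τ, f τ = p.eval₂ (Int.castRingHom ℂ) (kleinJ τ) := by
  induction M generalizing f P with
  | zero =>
    simp only [pow_zero, one_mul] at hf
    refine ⟨C (P.coeff 0), fun τ ↦ ?_⟩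
    rw [hf.eq_const_of_invariant hinv τ, PowerSeries.coeff_map, eval₂_C]
  | succ M ih =>
    obtain ⟨G, hG0, hG⟩ := exists_hasQExp_qParam_mul_kleinJ
    set c := P.coeff 0 with hc
    set Q : PowerSeries ℤ := P - PowerSeries.C c * G ^ (M + 1) with hQ
    have hQ0 : Q.coeff 0 = 0 := by
      rw [PowerSeries.coeff_zero_eq_constantCoeff_apply] at hc hG0 ⊢
      rw [hQ, map_sub, map_mul, map_pow, hG0, ← hc]
      simp
    have hQexp : HasQExp 1 (fun τ ↦ Periodic.qParam 1 τ *
        (Periodic.qParam 1 τ ^ M * (f τ - c * kleinJ τ ^ (M + 1))))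
        (Q.map (Int.castRingHom ℂ)) := by
      convert! hf.sub ((hG.pow (M + 1)).const_mul (c : ℂ)) using 1
      · ext τ
        simp only [Pi.sub_apply, Pi.pow_apply]
        ring
      · rw [hQ, map_sub, map_mul, map_pow, PowerSeries.map_C]
        rfl
    have h1 := hQexp.of_qParam_mul (by rw [PowerSeries.coeff_map, hQ0, map_zero])
    obtain ⟨p, hp⟩ := ih (fun τ ↦ f τ - c * kleinJ τ ^ (M + 1))
      (PowerSeries.mk fun n ↦ Q.coeff (n + 1)) (by convert! h1 using 1)
      (fun γ τ ↦ by simp only [hinv, kleinJ_smul])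
    refine ⟨p + C c * X ^ (M + 1), fun τ ↦ ?_⟩
    rw [eval₂_add, ← hp, eval₂_mul, eval₂_C, eval₂_pow, eval₂_X]
    simp

/-- The expansion of `j((aτ+b)/d)·e^{2πia²τ/s}` for a triple `(a, b, d)` with `ad = s`, written
formally with a root of unity `z` in a commutative ring. -/
def triSeries (G : PowerSeries ℤ) (s : ℕ) {A : Type*} [CommRing A] (z : A) (t : ℕ × ℕ × ℕ) :
    PowerSeries A :=
  PowerSeries.mk fun n ↦ if t.1 ^ 2 ∣ n then
    (G.coeff (n / t.1 ^ 2) : A) * z ^ (t.1 * t.2.1 * (n / t.1 ^ 2 + (s - 1))) else 0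

/-- The formal expansion of the polynomial with roots `j((aτ+b)/d)`, up to a normalising factor. -/
def triPolySeries (G : PowerSeries ℤ) (s : ℕ) {A : Type*} [CommRing A] (z : A) :
    Polynomial (PowerSeries A) :=
  ∏ t ∈ triReps s, (C (PowerSeries.X ^ t.1 ^ 2) * X - C (triSeries G s z t))

section Formal

variable (G : PowerSeries ℤ) (s : ℕ) {A B : Type*} [CommRing A] [CommRing B]

theorem triSeries_map (f : A →+* B) (z : A) (t : ℕ × ℕ × ℕ) :
    (triSeries G s z t).map f = triSeries G s (f z) t := by
  ext n
  simp only [triSeries, PowerSeries.coeff_map, PowerSeries.coeff_mk]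
  split_ifs <;> simp

theorem triPolySeries_map (f : A →+* B) (z : A) :
    (triPolySeries G s z).map (PowerSeries.map f) = triPolySeries G s (f z) := by
  simp [triPolySeries, Polynomial.map_prod, triSeries_map]

theorem triPolySeries_pow {z : A} (hz : z ^ s = 1) {r : ℕ} (hr : r.Coprime s) :
    triPolySeries G s (z ^ r) = triPolySeries G s z := by
  set e : ℕ × ℕ × ℕ → ℕ × ℕ × ℕ := fun t ↦ (t.1, r * t.2.1 % t.2.2, t.2.2) with he
  have hmem : ∀ t ∈ triReps s, e t ∈ triReps s := by
    rintro ⟨a, b, d⟩ ht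
    rw [mem_triReps] at ht ⊢
    obtain ⟨h1, h2, h3, h4, h5⟩ := ht
    simp only [he] at h1 h2 h3 h4 h5 ⊢
    refine ⟨h1, h2, h3, ?_, Nat.mod_lt _ h2⟩
    have hrd : r.Coprime d := hr.coprime_dvd_right ⟨a, by rw [← h3, mul_comm]⟩
    rwa [← Nat.gcd_rec, Nat.Coprime.gcd_mul_left_cancel_right _ hrd, Nat.gcd_comm d]
  have hinj : Set.InjOn e (triReps s) := by
    rintro ⟨a, b, d⟩ ht ⟨a', b', d'⟩ ht' h
    simp only [Finset.mem_coe, mem_triReps] at ht ht'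
    obtain ⟨h1, h2, h3, h4, h5⟩ := ht
    obtain ⟨h1', h2', h3', h4', h5'⟩ := ht'
    simp only [he, Prod.mk.injEq] at h
    obtain ⟨rfl, hb, rfl⟩ := h
    have hrd : r.Coprime d := hr.coprime_dvd_right ⟨a, by rw [← h3, mul_comm]⟩
    have h6 : b ≡ b' [MOD d] := Nat.ModEq.cancel_left_of_coprime hrd.symm hb
    rw [Nat.ModEq, Nat.mod_eq_of_lt h5, Nat.mod_eq_of_lt h5'] at h6
    rw [h6]
  refine Finset.prod_nbij e hmem hinj
    (Finset.surjOn_of_injOn_of_card_le e hmem hinj le_rfl) ?_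
  rintro ⟨a, b, d⟩ ht
  rw [mem_triReps] at ht
  obtain ⟨h1, h2, h3, h4, h5⟩ := ht
  simp only at h3
  congr 2
  ext n
  simp only [triSeries, PowerSeries.coeff_mk, he]
  split_ifs
  · congr 1
    have key : (z ^ r) ^ (a * b) = z ^ (a * (r * b % d)) := by
      have h7 : r * (a * b) = s * (r * b / d) + a * (r * b % d) := by
        conv_lhs => rw [← mul_assoc, mul_comm r a, mul_assoc, ← Nat.div_add_mod (r * b) d]
        rw [← h3]
        ring
      rw [← pow_mul, h7, pow_add, pow_mul, hz, one_pow, one_mul]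
    rw [pow_mul, key, ← pow_mul]
  · rfl

end Formal

theorem exists_int_triPolySeries_of_isCyclotomicExtension (G : PowerSeries ℤ) {s : ℕ}
    (hs : 1 ≤ s) (K : Type) [Field K] [Algebra ℚ K] [IsCyclotomicExtension {s} ℚ K] (k n : ℕ) :
    ∃ m : ℤ, ((triPolySeries G s (Complex.exp (2 * Real.pi * I / s))).coeff k).coeff n = m := by
  have : NeZero s := ⟨by lia⟩
  obtain ⟨z, hz⟩ : ∃ z : K, IsPrimitiveRoot z s := ⟨_, IsCyclotomicExtension.zeta_spec s ℚ K⟩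
  have : FiniteDimensional ℚ K := IsCyclotomicExtension.finiteDimensional {s} ℚ K
  have : IsGalois ℚ K := IsCyclotomicExtension.isGalois {s} ℚ K
  set x : K := ((triPolySeries G s z).coeff k).coeff n with hx
  have hxint : IsIntegral ℤ x := by
    let w : integralClosure ℤ K := ⟨z, hz.isIntegral (by lia)⟩
    have hw := triPolySeries_map G s (algebraMap (integralClosure ℤ K) K) w
    have : x = algebraMap (integralClosure ℤ K) K (((triPolySeries G s w).coeff k).coeff n) := by
      rw [hx, show z = algebraMap (integralClosure ℤ K) K w from rfl, ← hw, Polynomial.coeff_map,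
        PowerSeries.coeff_map]
    rw [this]
    exact Subtype.prop _
  have hpow : ∀ {R : Type} [CommRing R] [IsDomain R] {u v : R}, IsPrimitiveRoot u s →
      IsPrimitiveRoot v s → triPolySeries G s v = triPolySeries G s u := by
    intro R _ _ u v hu hv
    obtain ⟨r, -, hr, rfl⟩ := (hu.isPrimitiveRoot_iff).mp hv
    exact triPolySeries_pow G s hu.pow_eq_one hr
  have hfix : ∀ σ : K ≃ₐ[ℚ] K, σ x = x := by
    intro σ
    have h1 := triPolySeries_map G s (σ : K →+* K) z
    rw [hpow hz (hz.map_of_injective (f := (σ : K →+* K)) σ.injective)] at h1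
    conv_rhs => rw [hx, ← h1]
    rw [Polynomial.coeff_map, PowerSeries.coeff_map]
    rfl
  obtain ⟨y, hy⟩ := IntermediateField.mem_bot.mp ((IsGalois.mem_bot_iff_fixed x).mpr hfix)
  rw [← hy] at hxint
  obtain ⟨m, hm⟩ := IsIntegrallyClosed.isIntegral_iff.mp
    ((isIntegral_algebraMap_iff (algebraMap ℚ K).injective).mp hxint)
  refine ⟨m, ?_⟩
  let φ : K →ₐ[ℚ] ℂ := IsAlgClosed.lift
  have hφ := hpow (Complex.isPrimitiveRoot_exp s (by lia))
    (hz.map_of_injective (f := (φ : K →+* ℂ)) (φ : K →+* ℂ).injective)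
  rw [← hφ]
  erw [← triPolySeries_map G s (φ : K →+* ℂ) z]
  rw [Polynomial.coeff_map, PowerSeries.coeff_map, ← hx, ← hy, ← hm]
  simp

theorem exists_int_triPolySeries (G : PowerSeries ℤ) {s : ℕ} (hs : 1 ≤ s) (k n : ℕ) :
    ∃ m : ℤ, ((triPolySeries G s (Complex.exp (2 * Real.pi * I / s))).coeff k).coeff n = m :=
  have : NeZero s := ⟨by lia⟩
  @exists_int_triPolySeries_of_isCyclotomicExtension G s hs (CyclotomicField s ℚ) _
    (CyclotomicField.algebra s ℚ) (CyclotomicField.isCyclotomicExtension s ℚ) k n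

section Expansion

variable {s : ℕ} {G : PowerSeries ℤ}

theorem hasQExp_jC_moeb (hs : 1 ≤ s)
    (hG : HasQExp 1 (fun τ ↦ Periodic.qParam 1 τ * kleinJ τ) (G.map (Int.castRingHom ℂ)))
    {t : ℕ × ℕ × ℕ} (ht : t ∈ triReps s) :
    HasQExp s (fun τ ↦ Periodic.qParam s τ ^ t.1 ^ 2 * jC (moeb (triMat t) τ))
      (triSeries G s (Complex.exp (2 * Real.pi * I / s)) t) := by
  intro τ
  obtain ⟨a, b, d⟩ := t
  obtain ⟨ha, hd, had, -, -⟩ := mem_triReps.mp ht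
  simp only at ha hd had
  set ζ := Complex.exp (2 * Real.pi * I / s) with hζ
  have hs0 : (s : ℂ) ≠ 0 := by exact_mod_cast (by lia : s ≠ 0)
  have hd0 : (d : ℂ) ≠ 0 := by exact_mod_cast hd.ne'
  have had' : (s : ℂ) = a * d := by exact_mod_cast had.symm
  have hζs : ζ ^ s = 1 := (Complex.isPrimitiveRoot_exp s (by lia)).pow_eq_one
  have hdet : 0 < (triMat (a, b, d)).det := by
    rw [triMat, Matrix.det_fin_two_of]
    simp only [mul_zero, sub_zero]
    positivity
  obtain ⟨w, hw⟩ : ∃ w : ℍ, (w : ℂ) = moeb (triMat (a, b, d)) τ :=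
    ⟨⟨_, moeb_im_pos hdet τ.im_pos⟩, rfl⟩
  have hq : Periodic.qParam 1 (w : ℂ) = Periodic.qParam s (τ : ℂ) ^ a ^ 2 * ζ ^ (a * b) := by
    rw [hw, hζ, Periodic.qParam, Periodic.qParam, ← Complex.exp_nat_mul, ← Complex.exp_nat_mul,
      ← Complex.exp_add]
    congr 1
    simp only [moeb, triMat, Matrix.of_apply, Matrix.cons_val', Matrix.cons_val_zero,
      Matrix.cons_val_one, Matrix.cons_val_fin_one]
    push_cast
    rw [had']
    have ha0 : (a : ℂ) ≠ 0 := by exact_mod_cast ha.ne'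
    field_simp
    simp
    field_simp
  have h1 := (hG w).mul_left (ζ ^ (a * b * (s - 1)))
  have hab : ζ ^ (a * b * (s - 1)) * ζ ^ (a * b) = 1 := by
    rw [← pow_add, show a * b * (s - 1) + a * b = s * (a * b) by
      obtain ⟨r, rfl⟩ := Nat.exists_eq_add_of_le' hs
      simp
      ring, pow_mul, hζs, one_pow]
  have hinj : Injective fun m : ℕ ↦ a ^ 2 * m :=
    fun m n h ↦ Nat.eq_of_mul_eq_mul_left (by positivity) h
  refine (hinj.hasSum_iff ?_).mp ?_
  · intro n hn
    have : ¬ a ^ 2 ∣ n := fun ⟨m, hm⟩ ↦ hn ⟨m, hm.symm⟩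
    simp [triSeries, this]
  · convert! h1 using 1
    · ext m
      have ha2 : a ^ 2 * m / a ^ 2 = m := Nat.mul_div_cancel_left m (by positivity)
      simp only [comp_apply, triSeries, PowerSeries.coeff_mk, dvd_mul_right, if_true, ha2,
        PowerSeries.coeff_map, hq, eq_intCast]
      ring
    · simp only
      rw [← jC_coe, hq, hw]
      linear_combination -(Periodic.qParam s (τ : ℂ) ^ a ^ 2 *
        jC (moeb (triMat (a, b, d)) τ)) * hab

theorem hasQExp_coeff_prod {h : ℝ} {ι : Type*} (S : Finset ι) {p : ι → ℍ → ℂ[X]}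
    {P : ι → Polynomial (PowerSeries ℂ)}
    (H : ∀ i ∈ S, ∀ k, HasQExp h (fun τ ↦ (p i τ).coeff k) ((P i).coeff k)) (k : ℕ) :
    HasQExp h (fun τ ↦ (∏ i ∈ S, p i τ).coeff k) ((∏ i ∈ S, P i).coeff k) := by
  classical
  induction S using Finset.induction_on generalizing k with
  | empty =>
    simp only [Finset.prod_empty, coeff_one]
    split_ifs
    · exact HasQExp.one h
    · simpa using HasQExp.const h 0
  | insert i S hi ih =>
    simp only [Finset.prod_insert hi, coeff_mul]
    have h1 := HasQExp.sum (Finset.HasAntidiagonal.antidiagonal k) fun x _ ↦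
      (H i (Finset.mem_insert_self i S) x.1).mul
        (ih (fun j hj ↦ H j (Finset.mem_insert_of_mem hj)) x.2)
    intro τ
    have h2 := h1 τ
    rw [Finset.sum_apply] at h2
    exact h2

theorem hasQExp_coeff_triPoly (hs : 1 ≤ s)
    (hG : HasQExp 1 (fun τ ↦ Periodic.qParam 1 τ * kleinJ τ) (G.map (Int.castRingHom ℂ)))
    (k : ℕ) :
    HasQExp s (fun τ ↦ Periodic.qParam s τ ^ (∑ t ∈ triReps s, t.1 ^ 2) * (triPoly s τ).coeff k)
      ((triPolySeries G s (Complex.exp (2 * Real.pi * I / s))).coeff k) := by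
  convert! hasQExp_coeff_prod (triReps s) (h := s)
    (p := fun t τ ↦ C (Periodic.qParam s τ ^ t.1 ^ 2) * (X - C (jC (moeb (triMat t) τ))))
    (P := fun t ↦ C (PowerSeries.X ^ t.1 ^ 2) * X -
      C (triSeries G s (Complex.exp (2 * Real.pi * I / s)) t)) (fun t ht l ↦ ?_) k using 1
  · ext τ
    rw [Finset.prod_mul_distrib, ← map_prod, Finset.prod_pow_eq_pow_sum, coeff_C_mul, triPoly]
  · have h1 := hasQExp_jC_moeb hs hG ht
    have h2 := HasQExp.qParam_pow s (t.1 ^ 2)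
    have hz : HasQExp s (fun _ ↦ 0) 0 := by simpa using HasQExp.const s 0
    rcases l with _ | _ | l
    · convert! hz.sub h1 using 1
      · ext τ
        simp only [coeff_C_mul, coeff_sub, coeff_X_zero, coeff_C_zero, Pi.sub_apply]
        ring
      · simp only [coeff_C_mul, coeff_sub, coeff_X_zero, coeff_C_zero, mul_zero]
    · simpa only [coeff_C_mul, coeff_sub, zero_add, coeff_X_one, coeff_C_succ, sub_zero, mul_one]
        using h2
    · simpa only [coeff_C_mul, coeff_sub, coeff_X_of_ne_one (show l + 1 + 1 ≠ 1 by lia),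
        coeff_C_succ, sub_zero, mul_zero] using hz

/-- A function of period one whose expansion in `e^{2πiτ/s}` has integral coefficients
has an integral expansion in `e^{2πiτ}`. -/
theorem HasQExp.exists_int_of_add_one (hs : 1 ≤ s) {f : ℍ → ℂ} {P : PowerSeries ℤ}
    (hf : HasQExp s f (P.map (Int.castRingHom ℂ))) (hper : ∀ τ : ℍ, f ((1 : ℝ) +ᵥ τ) = f τ) :
    ∃ Q : PowerSeries ℤ, HasQExp 1 f (Q.map (Int.castRingHom ℂ)) := by
  set ζ := Complex.exp (2 * Real.pi * I / s) with hζ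
  have hs' : (0 : ℝ) < s := by exact_mod_cast hs
  have hprim : IsPrimitiveRoot ζ s := Complex.isPrimitiveRoot_exp s (by lia)
  have h1 : HasQExp s f (PowerSeries.mk fun n ↦ (P.coeff n : ℂ) * ζ ^ n) := by
    intro τ
    rw [← hper τ]
    convert! hf ((1 : ℝ) +ᵥ τ) using 2 with n
    rw [coe_vadd, qParam_add, PowerSeries.coeff_mk, PowerSeries.coeff_map, mul_pow]
    have : Periodic.qParam s ((1 : ℝ) : ℂ) = ζ := by
      rw [Periodic.qParam, hζ]
      simp
    rw [this]
    simp
    ring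
  have hzero : ∀ n, ¬ s ∣ n → P.coeff n = 0 := by
    intro n hn
    have h2 := congrArg (PowerSeries.coeff n) (h1.unique hf hs')
    rw [PowerSeries.coeff_mk, PowerSeries.coeff_map, eq_intCast] at h2
    by_contra hne
    have hne' : (P.coeff n : ℂ) ≠ 0 := by exact_mod_cast hne
    exact hn (hprim.pow_eq_one_iff_dvd n |>.mp (mul_left_cancel₀ hne' (by rw [h2, mul_one])))
  refine ⟨PowerSeries.mk fun n ↦ P.coeff (s * n), fun τ ↦ ?_⟩
  have hinj : Injective fun m : ℕ ↦ s * m :=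
    fun m n h ↦ Nat.eq_of_mul_eq_mul_left (by lia) h
  convert! (hinj.hasSum_iff ?_).mpr (hf τ) using 1
  · ext n
    simp [qParam_one_eq_pow hs, pow_mul]
  · intro n hn
    have : ¬ s ∣ n := fun ⟨m, hm⟩ ↦ hn ⟨m, hm.symm⟩
    simp [hzero n this]

theorem exists_polynomial_coeff_triPoly (hs : 1 ≤ s) (k : ℕ) :
    ∃ p : ℤ[X], ∀ τ : ℍ, (triPoly s τ).coeff k = p.eval₂ (Int.castRingHom ℂ) (kleinJ τ) := by
  obtain ⟨G, -, hG⟩ := exists_hasQExp_qParam_mul_kleinJ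
  set M := ∑ t ∈ triReps s, t.1 ^ 2 with hM
  choose E hE using exists_int_triPolySeries G hs k
  have h1 : HasQExp s (fun τ ↦ Periodic.qParam s τ ^ M * (triPoly s τ).coeff k)
      ((PowerSeries.mk E).map (Int.castRingHom ℂ)) := by
    convert! hasQExp_coeff_triPoly hs hG k using 1
    ext n
    simp [hE]
  have h2 : HasQExp s (fun τ ↦ Periodic.qParam 1 τ ^ M * (triPoly s τ).coeff k)
      ((PowerSeries.X ^ ((s - 1) * M) * PowerSeries.mk E).map (Int.castRingHom ℂ)) := by
    convert! (HasQExp.qParam_pow s ((s - 1) * M)).mul h1 using 1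
    · ext τ
      simp only [Pi.mul_apply]
      rw [qParam_one_eq_pow hs, ← pow_mul, ← mul_assoc, ← pow_add]
      congr 2
      obtain ⟨r, rfl⟩ := Nat.exists_eq_add_of_le' hs
      simp
      ring
    · simp
  have hper : ∀ τ : ℍ, triPoly s ((1 : ℝ) +ᵥ τ : ℍ) = triPoly s τ := by
    intro τ
    rw [← modular_T_smul, triPoly_smul hs]
  obtain ⟨Q, hQ⟩ := h2.exists_int_of_add_one hs fun τ ↦ by
    simp only [hper]
    rw [coe_vadd, qParam_add]
    have : Periodic.qParam 1 ((1 : ℝ) : ℂ) = 1 := qParam_self one_ne_zero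
    rw [this, one_mul]
  exact exists_polynomial_kleinJ M _ Q hQ fun γ τ ↦ by rw [triPoly_smul hs]

end Expansion

theorem Polynomial.eq_of_eval₂_kleinJ_eq {p p' : ℤ[X]}
    (h : ∀ τ : ℍ, p.eval₂ (Int.castRingHom ℂ) (kleinJ τ) =
      p'.eval₂ (Int.castRingHom ℂ) (kleinJ τ)) : p = p' := by
  obtain ⟨G, hG0, hG⟩ := exists_hasQExp_qParam_mul_kleinJ
  have hinf : (Set.range kleinJ).Infinite := by
    intro hfin
    obtain ⟨B, hB⟩ := hfin.isBounded.exists_norm_le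
    have h0 : Tendsto (fun τ : ℍ ↦ Periodic.qParam 1 (τ : ℂ)) atImInfty (𝓝 0) :=
      qParam_tendsto_atImInfty one_pos
    have h1 : Tendsto (fun τ : ℍ ↦ Periodic.qParam 1 (τ : ℂ) * kleinJ τ) atImInfty (𝓝 0) :=
      h0.zero_mul_isBoundedUnder_le
        (isBoundedUnder_of ⟨B, fun τ ↦ hB _ (Set.mem_range_self τ)⟩)
    have h2 := tendsto_nhds_unique h1 (hG.tendsto_atImInfty one_pos)
    simp [hG0] at h2
  apply Polynomial.map_injective (Int.castRingHom ℂ) Int.cast_injective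
  refine Polynomial.eq_of_infinite_eval_eq _ _ (hinf.mono ?_)
  rintro _ ⟨τ, rfl⟩
  simpa [eval_map] using h τ

theorem natDegree_triPoly {s : ℕ} (hs : 1 ≤ s) (z : ℂ) : (triPoly s z).natDegree = psi s := by
  rw [triPoly, natDegree_prod_of_monic _ _ fun _ _ ↦ monic_X_sub_C _]
  simp [card_triReps hs]

theorem triPoly_monic (s : ℕ) (z : ℂ) : (triPoly s z).Monic :=
  monic_prod_of_monic _ _ fun _ _ ↦ monic_X_sub_C _

theorem exists_isOrbitReps {s : ℕ} (hs : 1 ≤ s) : ∃ R : Fin (psi s) → Mat, IsOrbitReps s R := by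
  let e := (triReps s).equivFinOfCardEq (card_triReps hs)
  have h := isLeftReps_triReps hs
  refine ⟨fun ν ↦ triMat (e.symm ν), fun ν ↦ h.1 _, fun T hT hdet ↦ ?_⟩
  obtain ⟨t, ht, huniq⟩ := h.2 T hT hdet
  refine ⟨e t, by simpa using ht, fun ν hν ↦ ?_⟩
  rw [← huniq _ hν, Equiv.apply_symm_apply]

theorem exists_isModularPoly {s : ℕ} (hs : 1 ≤ s) : ∃ J, IsModularPoly s J := by
  choose p hp using exists_polynomial_coeff_triPoly hs
  set J : Polynomial ℤ[X] := X ^ psi s + ∑ k ∈ Finset.range (psi s), C (p k) * X ^ k with hJ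
  have hlt : (∑ k ∈ Finset.range (psi s), C (p k) * X ^ k : Polynomial ℤ[X]).degree <
      (psi s : WithBot ℕ) := by
    refine (degree_sum_le _ _).trans_lt ((Finset.sup_lt_iff (WithBot.bot_lt_coe _)).mpr ?_)
    intro k hk
    exact (degree_C_mul_X_pow_le _ _).trans_lt (by exact_mod_cast Finset.mem_range.mp hk)
  refine ⟨J, monic_X_pow_add hlt, natDegree_eq_of_degree_eq_some ?_, fun R hR z hz ↦ ?_⟩
  · rw [hJ, degree_add_eq_left_of_degree_lt (by rwa [degree_X_pow]), degree_X_pow]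
  · rw [IsLeftReps.prod_eq_triPoly hs hR hz, (triPoly_monic s z).as_sum, natDegree_triPoly hs]
    rw [hJ]
    simp only [Polynomial.map_add, Polynomial.map_pow, Polynomial.map_X, Polynomial.map_sum,
      Polynomial.map_mul, Polynomial.map_C]
    congr 1
    refine Finset.sum_congr rfl fun k _ ↦ ?_
    have h1 := hp k ⟨z, hz⟩
    rw [← jC_coe] at h1
    congr 2
    exact h1.symm

theorem IsModularPoly.unique {s : ℕ} (hs : 1 ≤ s) {J J' : Polynomial ℤ[X]}
    (hJ : IsModularPoly s J) (hJ' : IsModularPoly s J') : J = J' := by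
  obtain ⟨R, hR⟩ := exists_isOrbitReps hs
  ext1 k
  refine Polynomial.eq_of_eval₂_kleinJ_eq fun τ ↦ ?_
  have h := congrArg (coeff · k)
    ((hJ.2.2 R hR τ τ.im_pos).trans (hJ'.2.2 R hR τ τ.im_pos).symm)
  simpa [evalAtJ, jC_coe, coeff_map] using h

end ModularPolynomial

/-- For every s ≥ 1 there is a unique polynomial J_s(X,Y) ∈ ℤ[X,Y], monic in X
of degree ψ(s), such that J_s(X, j(ω)) = ∏_ν (X − j(S_ν·ω)) for all ω in the upper
half-plane and every complete system S₁,…,S_{ψ(s)} of representatives of the left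
SL₂(ℤ)-orbits of primitive integer matrices of determinant s. -/
theorem stmt2 (s : ℕ) (hs : 1 ≤ s) : ∃! J : Polynomial (Polynomial ℤ), IsModularPoly s J :=
  existsUnique_of_exists_of_unique (exists_isModularPoly hs) fun _ _ ↦ IsModularPoly.unique hs

end
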